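/- arXiv:2407.04683 — 2 statements merged into one kernel-verified Lean document; each statement's English description precedes it below -/
import Mathlib

section
/- Let D be an n×n matrix over 𝔽₂ and R = D·V a reduction of D. Then for every row index i with 1 ≤ i ≤ n and every j with 0 ≤ j ≤ n, the number of column indices k ≤ j such that column k of R is nonzero with pivot_R(k) ≥ i equals the rank of the submatrix of D consisting of rows i,…,n and columns 1,…,j. -/
/-- The pivot of a nonzero column `j` of `M` is the largest row index `i` with `M i j ≠ 0`. -/
def IsPivot {n : ℕ} (M : Matrix (Fin n) (Fin n) (ZMod 2)) (i j : Fin n) : Prop :=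
  M i j ≠ 0 ∧ ∀ i' : Fin n, i < i' → M i' j = 0

/-- A matrix is reduced if any two distinct nonzero columns have distinct pivots. -/
def Reduced {n : ℕ} (M : Matrix (Fin n) (Fin n) (ZMod 2)) : Prop :=
  ∀ j₁ j₂ i₁ i₂ : Fin n, j₁ ≠ j₂ → IsPivot M i₁ j₁ → IsPivot M i₂ j₂ → i₁ ≠ i₂

/-- A matrix is unipotent upper-triangular if it is upper-triangular with all
diagonal entries equal to `1`. -/
def UnipotentUpper {n : ℕ} (V : Matrix (Fin n) (Fin n) (ZMod 2)) : Prop :=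
  (∀ i : Fin n, V i i = 1) ∧ ∀ i j : Fin n, j < i → V i j = 0

/-- `lowLeftRank D i j` is the rank of the submatrix of `D` consisting of all rows with
(0-based) index `≥ i` and all columns with (0-based) index `< j`. -/
noncomputable def lowLeftRank {n : ℕ} (D : Matrix (Fin n) (Fin n) (ZMod 2)) (i j : ℕ) : ℕ :=
  (D.submatrix (fun a : {a : Fin n // i ≤ (a : ℕ)} => (a : Fin n))
    (fun b : {b : Fin n // (b : ℕ) < j} => (b : Fin n))).rank

theorem aux_rank {n : ℕ} (D V : Matrix (Fin n) (Fin n) (ZMod 2))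
    (hV : UnipotentUpper V) (i j : ℕ) : lowLeftRank (D * V) i j = lowLeftRank D i j := by
  unfold lowLeftRank
  have h : (D * V).submatrix (fun a : {a : Fin n // i ≤ (a : ℕ)} => (a : Fin n))
      (fun b : {b : Fin n // (b : ℕ) < j} => (b : Fin n)) =
      D.submatrix (fun a : {a : Fin n // i ≤ (a : ℕ)} => (a : Fin n))
      (fun b : {b : Fin n // (b : ℕ) < j} => (b : Fin n)) *
      V.submatrix (fun b : {b : Fin n // (b : ℕ) < j} => (b : Fin n))
      (fun b : {b : Fin n // (b : ℕ) < j} => (b : Fin n)) := by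
    ext a b
    simp only [Matrix.submatrix_apply, Matrix.mul_apply]
    rw [← Finset.sum_subtype (Finset.univ.filter (fun b : Fin n => (b : ℕ) < j)) (by simp)
      (fun k => D a k * V k b)]
    symm
    apply Finset.sum_subset (Finset.subset_univ _)
    intro x _ hx
    have hx' : j ≤ (x : ℕ) := by simpa using hx
    rw [hV.2 x b (Fin.lt_def.2 (lt_of_lt_of_le b.2 hx')), mul_zero]
  rw [h, Matrix.rank_mul_eq_left_of_isUnit_det]
  rw [Matrix.det_of_isUpperTriangular]
  · simp [hV.1]
  · intro a b hab
    exact hV.2 _ _ hab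

theorem aux_li {n : ℕ} {i : ℕ} {T : Type} [Fintype T] (f : T → {a : Fin n // i ≤ (a : ℕ)} → ZMod 2)
    (p : T → {a : Fin n // i ≤ (a : ℕ)}) (hp : Function.Injective p)
    (h1 : ∀ t, f t (p t) ≠ 0) (h2 : ∀ t r, p t < r → f t r = 0) : LinearIndependent (ZMod 2) f := by
  classical
  rw [Fintype.linearIndependent_iff]
  intro g hg
  by_contra! hne
  obtain ⟨t0, ht0⟩ := hne
  obtain ⟨t, ht, hmax⟩ := Finset.exists_max_image (Finset.univ.filter (fun t => g t ≠ 0)) p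
    ⟨t0, by simpa using ht0⟩
  have h := congrFun hg (p t)
  rw [Finset.sum_apply, Finset.sum_eq_single t] at h
  · have ht' : g t ≠ 0 := by simpa using ht
    exact mul_ne_zero ht' (h1 t) h
  · intro s _ hs
    by_cases hgs : g s = 0
    · simp [hgs]
    · have := hmax s (by simpa using hgs)
      have hlt : p s < p t := lt_of_le_of_ne this (fun e => hs (hp e))
      simp [h2 s _ hlt]
  · simp

theorem aux_piv {n : ℕ} (M : Matrix (Fin n) (Fin n) (ZMod 2)) (a k : Fin n) (h : M a k ≠ 0) :
    ∃ p, a ≤ p ∧ IsPivot M p k := by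
  classical
  obtain ⟨t, ht, hmax⟩ := Finset.exists_max_image (Finset.univ.filter (fun t => M t k ≠ 0)) id
    ⟨a, by simpa using h⟩
  refine ⟨t, hmax a (by simpa using h), by simpa using ht, fun b hb => ?_⟩
  by_contra hne
  exact absurd (hmax b (by simpa using hne)) (not_le.2 hb)

open Classical in
/-- In any reduction `R = D * V` of `D`, for every row index `i` and every `j ≤ n`, the
number of columns `k` among the first `j` columns of `R` that are nonzero with pivot `≥ i`
equals the rank of the submatrix of `D` with rows `i,…,n` (0-based: index `≥ i`) and the
first `j` columns. -/
theorem pivot_count_eq_rank (n : ℕ) (D V : Matrix (Fin n) (Fin n) (ZMod 2))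
    (hV : UnipotentUpper V) (hR : Reduced (D * V)) :
    ∀ i : Fin n, ∀ j : ℕ, j ≤ n →
      (Finset.univ.filter (fun k : Fin n =>
          (k : ℕ) < j ∧ ∃ p : Fin n, i ≤ p ∧ IsPivot (D * V) p k)).card =
        lowLeftRank D (i : ℕ) j := by
  intro i j _
  rw [← aux_rank D V hV]
  generalize D * V = R at hR
  unfold lowLeftRank
  rw [Matrix.rank_eq_finrank_span_cols, ← Fintype.card_subtype]
  let f : {k : Fin n // (k : ℕ) < j ∧ ∃ p : Fin n, i ≤ p ∧ IsPivot R p k} →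
      {a : Fin n // (i : ℕ) ≤ (a : ℕ)} → ZMod 2 := fun k a => R a k
  choose q hq1 hq2 using fun k : {k : Fin n // (k : ℕ) < j ∧ ∃ p : Fin n, i ≤ p ∧ IsPivot R p k} =>
    k.2.2
  have hli : LinearIndependent (ZMod 2) f := by
    refine aux_li f (fun k => ⟨q k, hq1 k⟩) ?_ (fun t => (hq2 t).1) (fun t r hr => (hq2 t).2 _ hr)
    intro s t hst
    by_contra hne
    exact hR s t (q s) (q t) (fun e => hne (Subtype.ext e)) (hq2 s) (hq2 t) (congrArg Subtype.val hst)
  rw [← finrank_span_eq_card hli]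
  suffices hs : Submodule.span (ZMod 2) (Set.range f) = Submodule.span (ZMod 2) (Set.range
      (R.submatrix (fun a : {a : Fin n // (i : ℕ) ≤ (a : ℕ)} => (a : Fin n))
        (fun b : {b : Fin n // (b : ℕ) < j} => (b : Fin n))).col) by rw [hs]
  apply le_antisymm
  · rw [Submodule.span_le]
    rintro _ ⟨k, rfl⟩
    exact Submodule.subset_span ⟨⟨k.1, k.2.1⟩, rfl⟩
  · rw [Submodule.span_le]
    rintro _ ⟨k, rfl⟩
    by_cases hk : ∃ p : Fin n, i ≤ p ∧ IsPivot R p k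
    · exact Submodule.subset_span ⟨⟨k.1, k.2, hk⟩, rfl⟩
    · suffices h0 : (R.submatrix (fun a : {a : Fin n // (i : ℕ) ≤ (a : ℕ)} => (a : Fin n))
        (fun b : {b : Fin n // (b : ℕ) < j} => (b : Fin n))).col k = 0 by
        rw [h0]
        exact Submodule.zero_mem _
      ext a
      by_contra hne
      obtain ⟨p, hp, hp'⟩ := aux_piv R a k hne
      exact hk ⟨p, le_trans a.2 hp, hp'⟩
end

section
/- Let D be an n×n matrix over 𝔽₂ and R = D·V a reduction of D. Suppose column j of D is nonzero with pivot_D(j) = i, and suppose that no column k < j of R is nonzero with pivot_R(k) = i. Then column j of R is nonzero with pivot_R(j) = i. -/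
theorem exists_pivot_ge {n : ℕ} (M : Matrix (Fin n) (Fin n) (ZMod 2)) (q k : Fin n)
    (h : M q k ≠ 0) : ∃ p, q ≤ p ∧ IsPivot M p k := by
  classical
  obtain ⟨p, hp, hmax⟩ := (Finset.univ.filter (fun p => M p k ≠ 0)).exists_max_image id
    ⟨q, by simpa using h⟩
  simp only [Finset.mem_filter, Finset.mem_univ, true_and, id] at hp hmax
  refine ⟨p, hmax q h, hp, fun i' hi => ?_⟩
  by_contra hne
  exact absurd (hmax i' hne) (not_le.mpr hi)

/-- Emergent pairs: if column `j` of `D` is nonzero with pivot `i`, and no earlier column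
`k < j` of the reduction `R = D * V` is nonzero with pivot `i`, then column `j` of `R` is
nonzero with pivot `i`. -/
theorem emergent_pair (n : ℕ) (D V : Matrix (Fin n) (Fin n) (ZMod 2))
    (hV : UnipotentUpper V) (hR : Reduced (D * V)) (i j : Fin n)
    (hD : IsPivot D i j)
    (hnone : ∀ k : Fin n, k < j → ¬ IsPivot (D * V) i k) :
    IsPivot (D * V) i j := by
  classical
  have hVt : V.BlockTriangular id := fun a b hab => hV.2 a b hab
  have hdet : V.det = 1 := by
    rw [Matrix.det_of_upperTriangular hVt]
    simp [hV.1]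
  have hu : IsUnit V.det := by rw [hdet]; exact isUnit_one
  haveI : Invertible V := Matrix.invertibleOfIsUnitDet V hu
  have hWt : V⁻¹.BlockTriangular id := Matrix.blockTriangular_inv_of_blockTriangular hVt
  have hDR : D = (D * V) * V⁻¹ := (Matrix.mul_nonsing_inv_cancel_right V D hu).symm
  generalize hW : V⁻¹ = W at *
  generalize hRR : D * V = R at *
  have hent : ∀ q, D q j = ∑ k, R q k * W k j := fun q => by
    rw [hDR, Matrix.mul_apply]
  have hex : ∃ k, R i k * W k j ≠ 0 := by
    by_contra hc
    push Not at hc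
    exact hD.1 (by rw [hent]; exact Finset.sum_eq_zero fun k _ => hc k)
  obtain ⟨k0, hk0⟩ := hex
  obtain ⟨p0, -, hp0⟩ := exists_pivot_ge R i k0 (left_ne_zero_of_mul hk0)
  obtain ⟨p, hp, hmax⟩ := (Finset.univ.filter
    (fun p => ∃ k, W k j ≠ 0 ∧ IsPivot R p k)).exists_max_image id
    ⟨p0, by simpa using ⟨k0, right_ne_zero_of_mul hk0, hp0⟩⟩
  simp only [Finset.mem_filter, Finset.mem_univ, true_and, id] at hp hmax
  obtain ⟨k, hWk, hpk⟩ := hp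
  have hle : ∀ q l, R q l * W l j ≠ 0 → q ≤ p := fun q l h => by
    obtain ⟨p', h1, h2⟩ := exists_pivot_ge R q l (left_ne_zero_of_mul h)
    exact h1.trans (hmax p' ⟨l, right_ne_zero_of_mul h, h2⟩)
  have hDp : D p j ≠ 0 := by
    rw [hent, Finset.sum_eq_single k]
    · exact mul_ne_zero hpk.1 hWk
    · intro l _ hl
      by_contra h
      obtain ⟨p', h1, h2⟩ := exists_pivot_ge R p l (left_ne_zero_of_mul h)
      have h3 := hmax p' ⟨l, right_ne_zero_of_mul h, h2⟩
      exact hR l k p' p hl h2 hpk (le_antisymm h3 h1)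
    · simp
  have hpi : p = i := by
    refine le_antisymm ?_ (hle i k0 hk0)
    by_contra h
    exact hDp (hD.2 p (not_le.mp h))
  subst hpi
  have hkj : k ≤ j := by
    by_contra h
    exact hWk (hWt (not_le.mp h))
  rcases hkj.lt_or_eq with h | h
  · exact absurd hpk (hnone k h)
  · exact h ▸ hpk
end
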